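/- arXiv:1106.1868 — 3 statements merged into one kernel-verified Lean document; each statement's English description precedes it below -/
import Mathlib

section
/- For all real x, one has g0 ≤ g(a0, b0, c0; x) ≤ 0, where g0 = −0.121585107. Moreover g(a0,b0,c0;·) is decreasing on (0, x0) and increasing on (x0, ∞), where x0 is the unique positive real root of 2x⁶ + 4x⁴ − 1. -/
namespace ZFR

noncomputable def kappa : ℝ := 1 / Real.sqrt 5

/-- `g(a,b,c;x) = κ (a/(a²+x²) + b/(b²+x²)) − c/(c²+x²)`. -/
noncomputable def g (a b c x : ℝ) : ℝ :=
  kappa * (a / (a ^ 2 + x ^ 2) + b / (b ^ 2 + x ^ 2)) - c / (c ^ 2 + x ^ 2)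

noncomputable def a0 : ℝ := (Real.sqrt 5 - 1) / 2
noncomputable def b0 : ℝ := (1 + Real.sqrt 5) / 2
noncomputable def c0 : ℝ := 1

/-- The values of `g a0 b0 c0`, as a rational function of `y = x²`. -/
noncomputable def profile (y : ℝ) : ℝ := -(y / (1 + 4 * y + 4 * y ^ 2 + y ^ 3))

theorem g_eq_profile (x : ℝ) : g a0 b0 c0 x = profile (x ^ 2) := by
  have hs : Real.sqrt 5 ^ 2 = 5 := Real.sq_sqrt (by norm_num)
  have hs1 : 2 < Real.sqrt 5 := Real.lt_sqrt_of_sq_lt (by norm_num)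
  unfold g profile kappa a0 b0 c0
  generalize Real.sqrt 5 = s at hs hs1
  have hy : 0 ≤ x ^ 2 := sq_nonneg x
  generalize x ^ 2 = y at hy
  have ha : 0 < ((s - 1) / 2) ^ 2 + y := by nlinarith
  have hb : 0 < ((1 + s) / 2) ^ 2 + y := by nlinarith
  have hq : 0 < 1 + 3 * y + y ^ 2 := by positivity
  have hprod : (((s - 1) / 2) ^ 2 + y) * (((1 + s) / 2) ^ 2 + y) = 1 + 3 * y + y ^ 2 := by
    linear_combination ((s ^ 2 + 3) / 16 + y / 2) * hs
  have hsum : 1 / s * ((s - 1) / 2 / (((s - 1) / 2) ^ 2 + y) +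
      (1 + s) / 2 / (((1 + s) / 2) ^ 2 + y)) = (1 + y) / (1 + 3 * y + y ^ 2) := by
    rw [div_add_div _ _ ha.ne' hb.ne', hprod, div_mul_div_comm, one_mul,
      div_eq_div_iff (by positivity) hq.ne']
    linear_combination (1 + 3 * y + y ^ 2) * s / 4 * hs
  have hden : 1 + 4 * y + 4 * y ^ 2 + y ^ 3 = (1 + 3 * y + y ^ 2) * (1 + y) := by ring
  rw [hsum, hden, one_pow, div_sub_div _ _ hq.ne' (by positivity), ← neg_div]
  congr 1
  ring

theorem profile_lower_bound {y : ℝ} (hy : 0 ≤ y) : -0.121585107 ≤ profile y := by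
  unfold profile
  rw [neg_le_neg_iff, div_le_iff₀ (by positivity)]
  nlinarith [mul_nonneg hy (sq_nonneg (y - 0.451606)), sq_nonneg (y - 0.4516059),
    sq_nonneg (y - 0.451607)]

theorem profile_nonpos {y : ℝ} (hy : 0 ≤ y) : profile y ≤ 0 := by
  unfold profile
  rw [neg_nonpos]
  positivity

theorem profile_sub_profile {u v : ℝ} (hu : 0 ≤ u) (hv : 0 ≤ v) :
    profile v - profile u = (v - u) * (4 * (u * v) + u * v * (u + v) - 1) /
      ((1 + 4 * u + 4 * u ^ 2 + u ^ 3) * (1 + 4 * v + 4 * v ^ 2 + v ^ 3)) := by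
  have h1 : 1 + 4 * u + 4 * u ^ 2 + u ^ 3 ≠ 0 := by positivity
  have h2 : 1 + 4 * v + 4 * v ^ 2 + v ^ 3 ≠ 0 := by positivity
  unfold profile
  field_simp
  ring

theorem profile_strictAntiOn {r : ℝ} (hr : 2 * r ^ 3 + 4 * r ^ 2 - 1 = 0) :
    StrictAntiOn profile (Set.Icc 0 r) := by
  intro u hu v hv huv
  have hu0 := hu.1
  have hv0 := hv.1
  have hr0 : 0 ≤ r := hv0.trans hv.2
  have h1 : u * v < r * r := by nlinarith [hv.2]
  have h2 : u * v * (u + v) ≤ r * r * (r + r) :=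
    mul_le_mul h1.le (add_le_add hu.2 hv.2) (by positivity) (by positivity)
  rw [← sub_neg, profile_sub_profile hu0 hv0]
  refine div_neg_of_neg_of_pos (mul_neg_of_pos_of_neg (sub_pos.2 huv) ?_) (by positivity)
  linarith

theorem profile_strictMonoOn {r : ℝ} (hr0 : 0 ≤ r) (hr : 2 * r ^ 3 + 4 * r ^ 2 - 1 = 0) :
    StrictMonoOn profile (Set.Ici r) := by
  intro u hu v hv huv
  have hru : r ≤ u := hu
  have hrv : r ≤ v := hv
  have hrpos : 0 < r := hr0.lt_of_ne (by rintro rfl; norm_num at hr)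
  have hu0 : 0 < u := hrpos.trans_le hru
  have hv0 : 0 < v := hrpos.trans_le hrv
  have h1 : r * r < u * v := by nlinarith
  have h2 : r * r * (r + r) ≤ u * v * (u + v) :=
    mul_le_mul h1.le (add_le_add hru hrv) (by positivity) (by positivity)
  rw [← sub_pos, profile_sub_profile hu0.le hv0.le]
  refine div_pos (mul_pos (sub_pos.2 huv) ?_) (by positivity)
  linarith

theorem existsUnique_pos_root :
    ∃! x : ℝ, 0 < x ∧ 2 * x ^ 6 + 4 * x ^ 4 - 1 = 0 := by
  have hmono : StrictMonoOn (fun x : ℝ => 2 * x ^ 6 + 4 * x ^ 4 - 1) (Set.Ici 0) := by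
    intro x hx y _ hxy
    have hx0 : (0 : ℝ) ≤ x := hx
    have h6 : x ^ 6 < y ^ 6 := pow_lt_pow_left₀ hxy hx0 (by norm_num)
    have h4 : x ^ 4 < y ^ 4 := pow_lt_pow_left₀ hxy hx0 (by norm_num)
    dsimp only
    linarith
  have hcont : ContinuousOn (fun x : ℝ => 2 * x ^ 6 + 4 * x ^ 4 - 1) (Set.Icc 0 1) := by
    fun_prop
  obtain ⟨x, hx, hroot⟩ := intermediate_value_Ioo zero_le_one hcont
    (show (0 : ℝ) ∈ Set.Ioo _ _ by norm_num)
  refine ⟨x, ⟨hx.1, hroot⟩, fun y hy => ?_⟩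
  exact hmono.injOn (Set.mem_Ici.2 hy.1.le) (Set.mem_Ici.2 hx.1.le) (hy.2.trans hroot.symm)

/-- For all real `x`, `g0 ≤ g(a0,b0,c0;x) ≤ 0` where `g0 = -0.121585107`; moreover
`g(a0,b0,c0;·)` is decreasing on `(0,x0)` and increasing on `(x0,∞)`, where `x0` is the
unique positive real root of `2x⁶ + 4x⁴ - 1`. -/
theorem g_bounds_and_monotonicity :
    (∀ x : ℝ, -0.121585107 ≤ g a0 b0 c0 x ∧ g a0 b0 c0 x ≤ 0) ∧
    (∃! x0 : ℝ, 0 < x0 ∧ 2 * x0 ^ 6 + 4 * x0 ^ 4 - 1 = 0) ∧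
    (∀ x0 : ℝ, 0 < x0 → 2 * x0 ^ 6 + 4 * x0 ^ 4 - 1 = 0 →
      StrictAntiOn (g a0 b0 c0) (Set.Ioo 0 x0) ∧
      StrictMonoOn (g a0 b0 c0) (Set.Ioi x0)) := by
  refine ⟨fun x => ?_, existsUnique_pos_root, fun x0 hx0 hroot => ?_⟩
  · rw [g_eq_profile]
    exact ⟨profile_lower_bound (sq_nonneg x), profile_nonpos (sq_nonneg x)⟩
  · have hr : 2 * (x0 ^ 2) ^ 3 + 4 * (x0 ^ 2) ^ 2 - 1 = 0 := by
      linear_combination hroot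
    constructor
    · intro u hu v hv huv
      rw [g_eq_profile, g_eq_profile]
      exact profile_strictAntiOn hr ⟨sq_nonneg u, pow_le_pow_left₀ hu.1.le hu.2.le 2⟩
        ⟨sq_nonneg v, pow_le_pow_left₀ hv.1.le hv.2.le 2⟩
        (pow_lt_pow_left₀ huv hu.1.le two_ne_zero)
    · intro u hu v hv huv
      rw [g_eq_profile, g_eq_profile]
      have hu' : x0 < u := hu
      have hv' : x0 < v := hv
      exact profile_strictMonoOn (sq_nonneg x0) hr (pow_le_pow_left₀ hx0.le hu'.le 2)
        (pow_le_pow_left₀ hx0.le hv'.le 2) (pow_lt_pow_left₀ huv (hx0.trans hu').le two_ne_zero)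

end ZFR
end

section
/- Let a, b, c > 0 and let 0 < ε < ε0. Suppose there exist constants m1, m2, m3 > 0 with |a − a0| < m1·ε, |b − b0| < m2·ε, |c − c0| < m3·ε, and with a0 − m1·ε0 > 0, b0 − m2·ε0 > 0, c0 − m3·ε0 > 0. Then for all real x, g0 − m0·ε ≤ g(a,b,c;x) ≤ m0·ε, where g0 = −0.121585107 and m0 = κ·m1/(a0 − m1·ε0)² + κ·m2/(b0 − m2·ε0)² + m3/(c0 − m3·ε0)². -/
namespace ZFR

/-- Perturbing the parameter of the Poisson-type kernel `p ↦ p / (p ^ 2 + x ^ 2)`. -/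
lemma abs_div_sq_add_sq_sub_le {p q d δ : ℝ} (x : ℝ) (hd : 0 < d) (hp : d ≤ p) (hq : d ≤ q)
    (h : |p - q| ≤ δ) :
    |p / (p ^ 2 + x ^ 2) - q / (q ^ 2 + x ^ 2)| ≤ δ / d ^ 2 := by
  have hp0 : 0 < p := hd.trans_le hp
  have hq0 : 0 < q := hd.trans_le hq
  have hP : 0 < p ^ 2 + x ^ 2 := by positivity
  have hQ : 0 < q ^ 2 + x ^ 2 := by positivity
  have hpq : d ^ 2 ≤ p * q := by nlinarith
  have hnum : |x ^ 2 - p * q| ≤ p * q + x ^ 2 := by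
    rw [abs_le]
    constructor <;> nlinarith [mul_pos hp0 hq0, sq_nonneg x]
  have hden : (p * q + x ^ 2) * d ^ 2 ≤ (p ^ 2 + x ^ 2) * (q ^ 2 + x ^ 2) := by
    calc (p * q + x ^ 2) * d ^ 2 ≤ (p * q + x ^ 2) * (p * q + x ^ 2) := by
          gcongr
          nlinarith [sq_nonneg x]
      _ ≤ (p ^ 2 + x ^ 2) * (q ^ 2 + x ^ 2) := by
          nlinarith [mul_nonneg (sq_nonneg (p - q)) (sq_nonneg x)]
  have heq : p / (p ^ 2 + x ^ 2) - q / (q ^ 2 + x ^ 2)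
      = (p - q) * (x ^ 2 - p * q) / ((p ^ 2 + x ^ 2) * (q ^ 2 + x ^ 2)) := by
    field_simp
    ring
  rw [heq, abs_div, abs_mul, abs_of_pos (mul_pos hP hQ), div_le_div_iff₀ (by positivity)
    (by positivity)]
  have hδ : 0 ≤ δ := (abs_nonneg _).trans h
  calc |p - q| * |x ^ 2 - p * q| * d ^ 2 ≤ δ * (p * q + x ^ 2) * d ^ 2 := by gcongr
    _ = δ * ((p * q + x ^ 2) * d ^ 2) := by ring
    _ ≤ δ * ((p ^ 2 + x ^ 2) * (q ^ 2 + x ^ 2)) := by gcongr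

/-- Closed form of `g` at the unperturbed parameters. -/
lemma g_a0_b0_c0 (x : ℝ) :
    g a0 b0 c0 x = -(x ^ 2 / (((x ^ 2) ^ 2 + 3 * x ^ 2 + 1) * (1 + x ^ 2))) := by
  have hs : Real.sqrt 5 ^ 2 = 5 := Real.sq_sqrt (by norm_num)
  have hs1 : 1 < Real.sqrt 5 := by
    rw [Real.lt_sqrt] <;> norm_num
  have hA : 0 < a0 ^ 2 + x ^ 2 := by
    have : 0 < a0 := by unfold a0; linarith
    positivity
  have hB : 0 < b0 ^ 2 + x ^ 2 := by
    have : 0 < b0 := by unfold b0; linarith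
    positivity
  have hsum : a0 + b0 = Real.sqrt 5 := by unfold a0 b0; ring
  have hprod : a0 * b0 = 1 := by unfold a0 b0; linear_combination hs / 4
  have hsq : a0 ^ 2 + b0 ^ 2 = 3 := by
    linear_combination (a0 + b0 + Real.sqrt 5) * hsum + hs - 2 * hprod
  have hD : (a0 ^ 2 + x ^ 2) * (b0 ^ 2 + x ^ 2) = (x ^ 2) ^ 2 + 3 * x ^ 2 + 1 := by
    linear_combination (a0 * b0 + 1) * hprod + x ^ 2 * hsq
  have hN : a0 / (a0 ^ 2 + x ^ 2) + b0 / (b0 ^ 2 + x ^ 2)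
      = Real.sqrt 5 * (1 + x ^ 2) / ((x ^ 2) ^ 2 + 3 * x ^ 2 + 1) := by
    rw [div_add_div _ _ hA.ne' hB.ne', hD]
    congr 1
    linear_combination (a0 + b0) * hprod + (1 + x ^ 2) * hsum
  unfold g kappa c0
  rw [hN]
  have h5 : Real.sqrt 5 ≠ 0 := by positivity
  have h1 : (x ^ 2) ^ 2 + 3 * x ^ 2 + 1 ≠ 0 := by positivity
  have h2 : 1 + x ^ 2 ≠ 0 := by positivity
  rw [one_pow]
  have hk : 1 / Real.sqrt 5 * (Real.sqrt 5 * (1 + x ^ 2) / ((x ^ 2) ^ 2 + 3 * x ^ 2 + 1))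
      = (1 + x ^ 2) / ((x ^ 2) ^ 2 + 3 * x ^ 2 + 1) := by
    field_simp
  rw [hk, div_sub_div _ _ h1 h2, ← neg_div]
  congr 1
  ring

lemma g_a0_b0_c0_nonpos (x : ℝ) : g a0 b0 c0 x ≤ 0 := by
  rw [g_a0_b0_c0, neg_nonpos]
  positivity

lemma le_g_a0_b0_c0 (x : ℝ) : -0.121585107 ≤ g a0 b0 c0 x := by
  rw [g_a0_b0_c0, neg_le_neg_iff, div_le_iff₀ (by positivity)]
  have hy := sq_nonneg x
  generalize x ^ 2 = y at *
  nlinarith [mul_nonneg (sq_nonneg (y - 0.4516059625)) (by linarith : 0 ≤ y + 4.903211925)]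

/-- Perturbed bounds for `g`: if `a,b,c` are within `m1 ε, m2 ε, m3 ε` of `a0,b0,c0`
respectively, then `g0 - m0 ε ≤ g(a,b,c;x) ≤ m0 ε` for all real `x`, where
`m0 = κ m1/(a0-m1 ε0)² + κ m2/(b0-m2 ε0)² + m3/(c0-m3 ε0)²` and `g0 = -0.121585107`. -/
theorem g_perturbed_bounds (a b c ε ε0 m1 m2 m3 : ℝ)
    (ha : 0 < a) (hb : 0 < b) (hc : 0 < c)
    (hε : 0 < ε) (hεε0 : ε < ε0)
    (hm1 : 0 < m1) (hm2 : 0 < m2) (hm3 : 0 < m3)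
    (hda : |a - a0| < m1 * ε) (hdb : |b - b0| < m2 * ε) (hdc : |c - c0| < m3 * ε)
    (hp1 : 0 < a0 - m1 * ε0) (hp2 : 0 < b0 - m2 * ε0) (hp3 : 0 < c0 - m3 * ε0) :
    ∀ x : ℝ,
      -0.121585107 - (kappa * m1 / (a0 - m1 * ε0) ^ 2 + kappa * m2 / (b0 - m2 * ε0) ^ 2
          + m3 / (c0 - m3 * ε0) ^ 2) * ε ≤ g a b c x ∧
      g a b c x ≤ (kappa * m1 / (a0 - m1 * ε0) ^ 2 + kappa * m2 / (b0 - m2 * ε0) ^ 2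
          + m3 / (c0 - m3 * ε0) ^ 2) * ε := by
  intro x
  have hA := abs_le.mp (abs_div_sq_add_sq_sub_le (p := a) (q := a0) x hp1
    (by nlinarith [(abs_lt.mp hda).1]) (by nlinarith) hda.le)
  have hB := abs_le.mp (abs_div_sq_add_sq_sub_le (p := b) (q := b0) x hp2
    (by nlinarith [(abs_lt.mp hdb).1]) (by nlinarith) hdb.le)
  have hC := abs_le.mp (abs_div_sq_add_sq_sub_le (p := c) (q := c0) x hp3
    (by nlinarith [(abs_lt.mp hdc).1]) (by nlinarith) hdc.le)
  have hk : 0 ≤ kappa := by unfold kappa; positivity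
  have hm : (kappa * m1 / (a0 - m1 * ε0) ^ 2 + kappa * m2 / (b0 - m2 * ε0) ^ 2
      + m3 / (c0 - m3 * ε0) ^ 2) * ε
      = kappa * (m1 * ε / (a0 - m1 * ε0) ^ 2) + kappa * (m2 * ε / (b0 - m2 * ε0) ^ 2)
        + m3 * ε / (c0 - m3 * ε0) ^ 2 := by ring
  have hlow := le_g_a0_b0_c0 x
  have hupp := g_a0_b0_c0_nonpos x
  rw [hm]
  unfold g at *
  have hA1 := mul_le_mul_of_nonneg_left hA.1 hk
  have hA2 := mul_le_mul_of_nonneg_left hA.2 hk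
  have hB1 := mul_le_mul_of_nonneg_left hB.1 hk
  have hB2 := mul_le_mul_of_nonneg_left hB.2 hk
  constructor <;> linarith [hC.1, hC.2]

end ZFR
end

section
/- Let a, b, t > 0 with 2a − b > 0. Then the function f1(x) = −a/x − b·x/(x² + t²) is strictly increasing on (0, ∞). -/
/-- If `a, b, t > 0` and `2a - b > 0`, then `f1(x) = -a/x - bx/(x²+t²)` is strictly
increasing on `(0,∞)`. -/
theorem f1_strictMonoOn (a b t : ℝ) (ha : 0 < a) (hb : 0 < b) (ht : 0 < t)
    (hab : 0 < 2 * a - b) :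
    StrictMonoOn (fun x : ℝ => -a / x - b * x / (x ^ 2 + t ^ 2)) (Set.Ioi 0) := by
  intro x hx y hy hxy
  have hx : 0 < x := hx
  have hy : 0 < y := hy
  have hxy' : 0 < x * y := mul_pos hx hy
  have hfactor : (-a / y - b * y / (y ^ 2 + t ^ 2)) - (-a / x - b * x / (x ^ 2 + t ^ 2)) =
      (y - x) * (a * t ^ 2 * (x - y) ^ 2 + (2 * a - b) * (x * y * t ^ 2) +
        (a + b) * (x * y) ^ 2 + a * t ^ 4) /
        (x * y * (x ^ 2 + t ^ 2) * (y ^ 2 + t ^ 2)) := by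
    field_simp
    ring
  have hdiff : 0 < y - x := sub_pos.mpr hxy
  refine sub_pos.mp ?_
  beta_reduce
  rw [hfactor]
  positivity
end
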